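/- Assume Setup (*). Then there is a colour c ∈ C_{01} with c ≠ α_{01} such that the monic B^{c α_{12}} (the monic with one vertex in every part, E_{01}-colour c, and E_{ij}-colour α_{ij} for every other pair i < j) is realized in G. -/

import Mathlib

/-!
Common framework: coloured multipartite graphs in a finite language `L`.
Colours are natural numbers; for each pair of distinct parts `i j : Fin m`
there is a finite nonempty colour set `C i j`.
-/

/-- A finite language for coloured `m`-partite graphs. -/
structure MLang (m : ℕ) where
  C : Fin m → Fin m → Finset ℕ
  symm : ∀ i j, C i j = C j i
  nonempty : ∀ i j, i ≠ j → (C i j).Nonempty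

/-- A coloured `m`-partite `L`-graph: vertices partitioned into parts `V_0, …, V_{m-1}`,
with a symmetric colouring of cross-part pairs taking values in the colour sets of `L`.
(The value of `colour` on pairs within a part is irrelevant junk data.) -/
structure LGraph {m : ℕ} (L : MLang m) where
  V : Type
  part : V → Fin m
  colour : V → V → ℕ
  colour_symm : ∀ x y, colour x y = colour y x
  colour_mem : ∀ x y, part x ≠ part y → colour x y ∈ L.C (part x) (part y)

namespace LGraph

variable {m : ℕ} {L : MLang m}

/-- The induced subgraph of `A` on a set `S` of its vertices. -/
def restrict (A : LGraph L) (S : Set A.V) : LGraph L where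
  V := S
  part x := A.part x.1
  colour x y := A.colour x.1 y.1
  colour_symm := fun x y => A.colour_symm x.1 y.1
  colour_mem := fun x y h => A.colour_mem x.1 y.1 h

/-- `f` is an embedding of `A` into `G`: injective, part-preserving, colour-preserving. -/
def IsEmbedding (A G : LGraph L) (f : A.V → G.V) : Prop :=
  Function.Injective f ∧ (∀ x, G.part (f x) = A.part x) ∧
    ∀ x y : A.V, A.part x ≠ A.part y → G.colour (f x) (f y) = A.colour x y

/-- `A` is realized in `G`, i.e. `A` embeds into `G`. -/
def Realized (G A : LGraph L) : Prop := ∃ f : A.V → G.V, IsEmbedding A G f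

/-- `A` and `B` are isomorphic `L`-graphs. -/
def IsIsomorphic (A B : LGraph L) : Prop :=
  ∃ f : A.V → B.V, IsEmbedding A B f ∧ Function.Surjective f

/-- `φ` restricted to `S` is an isomorphism between induced subgraphs of `G`
(a partial automorphism of `G`). -/
def IsPartialIso (G : LGraph L) (S : Set G.V) (φ : G.V → G.V) : Prop :=
  Set.InjOn φ S ∧ (∀ x ∈ S, G.part (φ x) = G.part x) ∧
    ∀ x ∈ S, ∀ y ∈ S, G.part x ≠ G.part y → G.colour (φ x) (φ y) = G.colour x y

/-- `G` is homogeneous: every isomorphism between finite induced subgraphs of `G`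
extends to an automorphism of `G`. -/
def Homogeneous (G : LGraph L) : Prop :=
  ∀ S : Set G.V, S.Finite → ∀ φ : G.V → G.V, G.IsPartialIso S φ →
    ∃ ψ : G.V ≃ G.V, (∀ x, G.part (ψ x) = G.part x) ∧
      (∀ x y : G.V, G.part x ≠ G.part y → G.colour (ψ x) (ψ y) = G.colour x y) ∧
      ∀ x ∈ S, ψ x = φ x

/-- `G` is `m`-generic: every part is countably infinite and every bipartite
restriction is generic. -/
def Generic (G : LGraph L) : Prop :=
  Countable G.V ∧ (∀ i : Fin m, {x : G.V | G.part x = i}.Infinite) ∧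
    ∀ i j : Fin m, i ≠ j → ∀ U : Finset G.V, (∀ u ∈ U, G.part u = i) →
      ∀ f : G.V → ℕ, (∀ u ∈ U, f u ∈ L.C i j) →
        ∃ x : G.V, G.part x = j ∧ ∀ u ∈ U, G.colour x u = f u

/-- `A` is minimally omitted from `G` (membership in `O(G)`): `A` is finite and omitted,
but every proper induced subgraph of `A` is realized in `G`. -/
def MinOmitted (G A : LGraph L) : Prop :=
  Finite A.V ∧ ¬ G.Realized A ∧ ∀ S : Set A.V, S ≠ Set.univ → G.Realized (A.restrict S)

/-- `A` is monic: at most one vertex in each part. -/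
def Monic (A : LGraph L) : Prop := ∀ x y : A.V, A.part x = A.part y → x = y

/-- `A` covers colour `c` on the restriction `V_i V_j`: it has vertices in `V_i` and `V_j`
joined by a `c`-coloured edge. -/
def Covers (A : LGraph L) (i j : Fin m) (c : ℕ) : Prop :=
  ∃ x y : A.V, A.part x = i ∧ A.part y = j ∧ A.colour x y = c

/-- `A` is an `ijk`-triangle: a monic with vertices in exactly the parts `V_i, V_j, V_k`. -/
def IsTriangleOn (A : LGraph L) (i j k : Fin m) : Prop :=
  A.Monic ∧ (∀ x : A.V, A.part x = i ∨ A.part x = j ∨ A.part x = k) ∧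
    (∃ x : A.V, A.part x = i) ∧ (∃ x : A.V, A.part x = j) ∧ (∃ x : A.V, A.part x = k)

/-- `A` is a triangle: an `ijk`-triangle for some pairwise distinct `i, j, k`. -/
def IsTriangle (A : LGraph L) : Prop :=
  ∃ i j k : Fin m, i ≠ j ∧ i ≠ k ∧ j ≠ k ∧ A.IsTriangleOn i j k

end LGraph

open LGraph

variable {m : ℕ} {L : MLang m}

/-- A `C_{ij}`-cover set: a set of monics covering every colour of `C i j` on `V_i V_j`. -/
def IsCoverSet (𝒜 : Set (LGraph L)) (i j : Fin m) : Prop :=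
  (∀ A ∈ 𝒜, A.Monic) ∧ ∀ c ∈ L.C i j, ∃ A ∈ 𝒜, A.Covers i j c

/-- A `C_{ij}^{kl}`-omission set with code `(i,j,k,l; cik, cil, cjk, cjl)`:
a `C_{ij}`-cover set of `ijk`-triangles and `ijl`-triangles all of whose
`E_{ik}, E_{il}, E_{jk}, E_{jl}`-edges have the indicated colours. -/
def IsOmissionSet (S : Set (LGraph L)) (i j k l : Fin m) (cik cil cjk cjl : ℕ) : Prop :=
  IsCoverSet S i j ∧
  (∀ A ∈ S, A.IsTriangleOn i j k ∨ A.IsTriangleOn i j l) ∧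
  (∀ A ∈ S, ∀ x y : A.V, A.part x = i → A.part y = k → A.colour x y = cik) ∧
  (∀ A ∈ S, ∀ x y : A.V, A.part x = i → A.part y = l → A.colour x y = cil) ∧
  (∀ A ∈ S, ∀ x y : A.V, A.part x = j → A.part y = k → A.colour x y = cjk) ∧
  (∀ A ∈ S, ∀ x y : A.V, A.part x = j → A.part y = l → A.colour x y = cjl)

/-- The code `(i,j,k,l; cik, cil, cjk, cjl)` is based on the cover set `𝒜`. -/
def BasedOn (𝒜 : Set (LGraph L)) (i j k l : Fin m) (cik cil cjk cjl : ℕ) : Prop :=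
  ∃ A ∈ 𝒜, ∃ A' ∈ 𝒜,
    A.Covers i k cik ∧ A.Covers j k cjk ∧ A'.Covers i l cil ∧ A'.Covers j l cjl

/-- The code `(i,j,k,l; cik, cil, cjk, cjl)` is based on triangles from the cover set `𝒜`. -/
def BasedOnTriangles (𝒜 : Set (LGraph L)) (i j k l : Fin m) (cik cil cjk cjl : ℕ) : Prop :=
  ∃ A ∈ 𝒜, ∃ A' ∈ 𝒜, A.IsTriangle ∧ A'.IsTriangle ∧
    A.Covers i k cik ∧ A.Covers j k cjk ∧ A'.Covers i l cil ∧ A'.Covers j l cjl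

/-- The age of `G`: the class of finite `L`-graphs embedding into `G`. -/
def Age (G : LGraph L) : Set (LGraph L) := {A | Finite A.V ∧ G.Realized A}

/-- `Forb F`: the class of finite `L`-graphs into which no member of `F` embeds. -/
def Forb (F : Set (LGraph L)) : Set (LGraph L) :=
  {B | Finite B.V ∧ ∀ A ∈ F, ¬ B.Realized A}

/-- An amalgamation class: a class of finite `L`-graphs closed under isomorphism and
induced subgraphs with the amalgamation property. -/
def IsAmalgamationClass (𝒞 : Set (LGraph L)) : Prop :=
  (∀ A ∈ 𝒞, Finite A.V) ∧
  (∀ A ∈ 𝒞, ∀ B : LGraph L, A.IsIsomorphic B → B ∈ 𝒞) ∧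
  (∀ A ∈ 𝒞, ∀ S : Set A.V, A.restrict S ∈ 𝒞) ∧
  ∀ A B₁ B₂ : LGraph L, A ∈ 𝒞 → B₁ ∈ 𝒞 → B₂ ∈ 𝒞 →
    ∀ (f₁ : A.V → B₁.V) (f₂ : A.V → B₂.V),
      IsEmbedding A B₁ f₁ → IsEmbedding A B₂ f₂ →
      ∃ C ∈ 𝒞, ∃ (g₁ : B₁.V → C.V) (g₂ : B₂.V → C.V),
        IsEmbedding B₁ C g₁ ∧ IsEmbedding B₂ C g₂ ∧ g₁ ∘ f₁ = g₂ ∘ f₂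

section Parts01

variable [NeZero m]

/-- `A ≤₀₁ B`: `A` is an off-`E_{01}`-subgraph of `B`, i.e. `A` embeds into `B` ignoring
the colours of edges between `V_0` and `V_1` (equivalently, `A` embeds into the graph
obtained from `B` by recolouring its `E_{01}`-edge with the `E_{01}`-colour of `A`). -/
def Le01 (A B : LGraph L) : Prop :=
  ∃ f : A.V → B.V, Function.Injective f ∧ (∀ x, B.part (f x) = A.part x) ∧
    ∀ x y : A.V, A.part x ≠ A.part y →
      ¬((A.part x = 0 ∧ A.part y = 1) ∨ (A.part x = 1 ∧ A.part y = 0)) →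
      B.colour (f x) (f y) = A.colour x y

/-- `A` and `B` are off-`E_{01}`-isomorphic. -/
def OffIso01 (A B : LGraph L) : Prop := Le01 A B ∧ Le01 B A

/-- `A` is a maximal element of the quasi-order `(𝒜, ≤₀₁)`. -/
def MaxIn (𝒜 : Set (LGraph L)) (A : LGraph L) : Prop :=
  A ∈ 𝒜 ∧ ∀ B ∈ 𝒜, Le01 A B → Le01 B A

/-- `𝒜 ∈ Λ`: a `C_{01}`-cover set contained in `O(G)` of size exactly `|C_{01}|`. -/
def InLambda (G : LGraph L) (𝒜 : Set (LGraph L)) : Prop :=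
  (∀ A ∈ 𝒜, G.MinOmitted A) ∧ IsCoverSet 𝒜 0 1 ∧ 𝒜.ncard = (L.C 0 1).card

/-- The graph obtained from `A` by recolouring its `E_{01}`-edge with `α`
(that is, `A^{c/α}` where `c` is the `E_{01}`-colour of `A`) is realized in `G`. -/
def RealizedRecoloured01 (G A : LGraph L) (α : ℕ) : Prop :=
  ∃ f : A.V → G.V, Function.Injective f ∧ (∀ x, G.part (f x) = A.part x) ∧
    (∀ x y : A.V, A.part x ≠ A.part y →
      ¬((A.part x = 0 ∧ A.part y = 1) ∨ (A.part x = 1 ∧ A.part y = 0)) →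
      G.colour (f x) (f y) = A.colour x y) ∧
    ∀ x y : A.V, A.part x = 0 → A.part y = 1 → G.colour (f x) (f y) = α

/-- `Ω₀₁(𝒜) ⊆ Ω₀₁(ℬ)`: every code `(0,1,k,l; c_{0k}, c_{0l}, c_{1k}, c_{1l})`
based on `𝒜` is based on `ℬ`. -/
def Omega01Le (𝒜 ℬ : Set (LGraph L)) : Prop :=
  ∀ k l : Fin m, k ≠ l → k ≠ 0 → k ≠ 1 → l ≠ 0 → l ≠ 1 →
    ∀ c0k c0l c1k c1l : ℕ,
      BasedOn 𝒜 0 1 k l c0k c0l c1k c1l → BasedOn ℬ 0 1 k l c0k c0l c1k c1l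

/-- `ℬ` is a good `C_{01}`-cover set (for `G`): there is a key colour `α ∈ C_{01}` with key
monic `A^α ∈ ℬ` such that every member of `ℬ`, after recolouring its `E_{01}`-edge by `α`,
is either an (off-`E_{01}`-)subgraph of `A^α` or realized in `G`. -/
def GoodCoverSet (G : LGraph L) (ℬ : Set (LGraph L)) : Prop :=
  ∃ α ∈ L.C 0 1, ∃ Aα ∈ ℬ, Aα.Covers 0 1 α ∧
    ∀ A ∈ ℬ, Le01 A Aα ∨ RealizedRecoloured01 G A α

/-- `ℬ` is a star `C_{01}`-cover set: good, with a key monic which either has vertices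
in at least four parts, or has vertices in exactly three parts `V_0, V_1, V_i` while no
other member of `ℬ` has vertices in all of the remaining parts. -/
def StarCoverSet (G : LGraph L) (ℬ : Set (LGraph L)) : Prop :=
  ∃ α ∈ L.C 0 1, ∃ Aα ∈ ℬ, Aα.Covers 0 1 α ∧
    (∀ A ∈ ℬ, Le01 A Aα ∨ RealizedRecoloured01 G A α) ∧
    (4 ≤ (Set.range Aα.part).ncard ∨
      ∃ i : Fin m, i ≠ 0 ∧ i ≠ 1 ∧ Set.range Aα.part = {0, 1, i} ∧
        ∀ B ∈ ℬ, B ≠ Aα → ∃ p : Fin m, p ≠ 0 ∧ p ≠ 1 ∧ p ≠ i ∧ p ∉ Set.range B.part)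

/-- `B` is a copy of the monic `B^{cd}` (relative to the background colours `α`): a monic
with exactly one vertex in every part, `E_{01}`-colour `c`, `E_{12}`-colour `d`, and
`E_{ij}`-colour `α i j` for every other pair of distinct parts. -/
def IsBcd (B : LGraph L) (α : Fin m → Fin m → ℕ) (c d : ℕ) : Prop :=
  B.Monic ∧ (∀ i : Fin m, ∃ x : B.V, B.part x = i) ∧
  (∀ x y : B.V, B.part x = 0 → B.part y = 1 → B.colour x y = c) ∧
  (∀ x y : B.V, B.part x = 1 → B.part y = 2 → B.colour x y = d) ∧
  (∀ x y : B.V, B.part x ≠ B.part y →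
    ¬((B.part x = 0 ∧ B.part y = 1) ∨ (B.part x = 1 ∧ B.part y = 0)) →
    ¬((B.part x = 1 ∧ B.part y = 2) ∨ (B.part x = 2 ∧ B.part y = 1)) →
    B.colour x y = α (B.part x) (B.part y))

end Parts01

/-- A realization of an induced subgraph, extended to a total function. -/
theorem realized_restrict_total {m : ℕ} {L : MLang m} (G A : LGraph L) (S : Set A.V)
    (g0 : G.V) (h : G.Realized (A.restrict S)) :
    ∃ f : A.V → G.V, Set.InjOn f S ∧ (∀ x ∈ S, G.part (f x) = A.part x) ∧
      ∀ x ∈ S, ∀ y ∈ S, A.part x ≠ A.part y → G.colour (f x) (f y) = A.colour x y := by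
  classical
  obtain ⟨f, hi, hp, hc⟩ := h
  have key : ∀ x (hx : x ∈ S), (fun x => if h : x ∈ S then f ⟨x, h⟩ else g0) x = f ⟨x, hx⟩ :=
    fun x hx => by simp [hx]
  refine ⟨fun x => if h : x ∈ S then f ⟨x, h⟩ else g0, ?_, ?_, ?_⟩
  · intro x hx y hy hxy
    rw [key x hx, key y hy] at hxy
    exact congrArg Subtype.val (hi hxy)
  · intro x hx
    have := key x hx
    exact (congrArg G.part this).trans (hp ⟨x, hx⟩)
  · intro x hx y hy hxy
    have h1 := key x hx
    have h2 := key y hy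
    exact (congrArg₂ G.colour h1 h2).trans (hc ⟨x, hx⟩ ⟨y, hy⟩ hxy)

/-- Two-point amalgamation inside a homogeneous graph: if `A` without `a` and `A` without `u` are
realized, then `A` is realized up to the colour of the pair `a u`. -/
theorem two_point_amalgam {m : ℕ} {L : MLang m} (G A : LGraph L) (hG : G.Homogeneous)
    (hA : G.MinOmitted A) (g0 : G.V) (a u : A.V) (hau : A.part a ≠ A.part u) :
    ∃ g : A.V → G.V, Function.Injective g ∧ (∀ x, G.part (g x) = A.part x) ∧
      ∀ x y : A.V, A.part x ≠ A.part y → ¬ ((x = a ∧ y = u) ∨ (x = u ∧ y = a)) →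
        G.colour (g x) (g y) = A.colour x y := by
  classical
  obtain ⟨hfin, -, hreal⟩ := hA
  have hne : ∀ v : A.V, ({v}ᶜ : Set A.V) ≠ Set.univ := by
    intro v h
    have : v ∈ ({v}ᶜ : Set A.V) := h ▸ Set.mem_univ v
    exact this rfl
  obtain ⟨f, fi, fp, fc⟩ := realized_restrict_total G A _ g0 (hreal _ (hne a))
  obtain ⟨k, ki, kp, kc⟩ := realized_restrict_total G A _ g0 (hreal _ (hne u))
  have : Nonempty A.V := ⟨a⟩
  let T : Set A.V := {x | x ≠ a ∧ x ≠ u}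
  have kiT : Set.InjOn k T := fun x hx y hy h => ki hx.2 hy.2 h
  let φ : G.V → G.V := fun z => f (Function.invFunOn k T z)
  have hφ : ∀ x ∈ T, φ (k x) = f x := by
    intro x hx
    exact congrArg f (kiT.leftInvOn_invFunOn hx)
  obtain ⟨ψ, ψp, ψc, ψφ⟩ := hG (Set.image k T) (Set.toFinite _) φ (by
    refine ⟨?_, ?_, ?_⟩
    · rintro _ ⟨x, hx, rfl⟩ _ ⟨y, hy, rfl⟩ h
      rw [hφ x hx, hφ y hy] at h
      rw [fi hx.1 hy.1 h]
    · rintro _ ⟨x, hx, rfl⟩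
      rw [hφ x hx, fp x hx.1, kp x hx.2]
    · rintro _ ⟨x, hx, rfl⟩ _ ⟨y, hy, rfl⟩ h
      rw [kp x hx.2, kp y hy.2] at h
      rw [hφ x hx, hφ y hy, fc x hx.1 y hy.1 h, kc x hx.2 y hy.2 h])
  have hψ : ∀ x, x ≠ a → x ≠ u → f x = ψ (k x) := fun x h1 h2 => by
    rw [ψφ _ ⟨x, ⟨h1, h2⟩, rfl⟩, hφ x ⟨h1, h2⟩]
  have hane : a ≠ u := fun h => hau (by rw [h])
  have pa : G.part (ψ (k a)) = A.part a := by rw [ψp, kp a hane]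
  have hinj : ∀ x, x ≠ a → f x ≠ ψ (k a) := by
    intro x hx h
    by_cases hxu : x = u
    · subst hxu
      apply hau
      rw [← pa, ← h, fp x hx]
    · rw [hψ x hx hxu] at h
      exact hx (ki hxu hane (ψ.injective h))
  have hcol : ∀ x, x ≠ a → x ≠ u → A.part x ≠ A.part a →
      G.colour (f x) (ψ (k a)) = A.colour x a := by
    intro x h1 h2 h
    rw [hψ x h1 h2, ψc _ _ (by rw [kp x h2, kp a hane]; exact h), kc x h2 a hane h]
  refine ⟨fun x => if x = a then ψ (k a) else f x, ?_, ?_, ?_⟩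
  · intro x y h
    by_cases hx : x = a <;> by_cases hy : y = a <;> simp only [hx, hy, if_true, if_false] at h
    · rw [hx, hy]
    · exact absurd h.symm (hinj y hy)
    · exact absurd h (hinj x hx)
    · exact fi hx hy h
  · intro x
    by_cases hx : x = a
    · simp only [hx, if_true, pa]
    · simp only [hx, if_false, fp x hx]
  · intro x y hxy hn
    by_cases hx : x = a <;> by_cases hy : y = a
    · exact absurd (by rw [hx, hy]) hxy
    · have hyu : y ≠ u := fun h => hn (Or.inl ⟨hx, h⟩)
      simp only [hx, hy, if_true, if_false]
      rw [G.colour_symm, A.colour_symm]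
      exact hcol y hy hyu (by rw [← hx]; exact hxy.symm)
    · have hxu : x ≠ u := fun h => hn (Or.inr ⟨h, hy⟩)
      simp only [hx, hy, if_true, if_false]
      exact hcol x hx hxu (by rw [← hy]; exact hxy)
    · simp only [hx, hy, if_false]
      exact fc x hx y hy hxy

/-- Under Setup (*), for some colour `c ∈ C_{01} - {α_{01}}` the monic
`B^{c α_{12}}` is realized in `G`. -/
theorem some_Bc_alpha_realized
    {m : ℕ} [NeZero m] {L : MLang m} (hm : 3 ≤ m)
    (hIH : ∀ m' : ℕ, 3 ≤ m' → m' < m → ∀ L' : MLang m', ∀ G' : LGraph L',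
      G'.Homogeneous → G'.Generic → ∀ B : LGraph L', G'.MinOmitted B → B.Monic)
    (G : LGraph L) (hG : G.Homogeneous) (hgen : G.Generic)
    (A : LGraph L) (hA : G.MinOmitted A) (hAnm : ¬ A.Monic)
    (hmin : ∀ B : LGraph L, G.MinOmitted B → ¬ B.Monic → Nat.card A.V ≤ Nat.card B.V)
    (α : Fin m → Fin m → ℕ)
    (hα : ∀ x y : A.V, A.part x ≠ A.part y → A.colour x y = α (A.part x) (A.part y))
    (hall : ∀ i : Fin m, ∃ x : A.V, A.part x = i)
    (hV0 : ∃ a b : A.V, a ≠ b ∧ A.part a = 0 ∧ A.part b = 0) :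
    ∃ c ∈ L.C 0 1, c ≠ α 0 1 ∧ ∃ B : LGraph L, IsBcd B α c (α 1 2) ∧ G.Realized B := by
  choose s hs using hall
  have h01 : (0 : Fin m) ≠ 1 := by
    obtain ⟨n, rfl⟩ := Nat.exists_eq_add_of_le' hm
    intro h
    have := congrArg Fin.val h
    simp at this
  have h02 : (0 : Fin m) ≠ 2 := by
    obtain ⟨n, rfl⟩ := Nat.exists_eq_add_of_le' hm
    intro h
    have := congrArg Fin.val h
    have h2 : ((2 : Fin (n + 3)) : ℕ) = 2 := Nat.mod_eq_of_lt (show 2 < n + 3 by omega)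
    rw [h2] at this
    simp at this
  have h12 : (1 : Fin m) ≠ 2 := by
    obtain ⟨n, rfl⟩ := Nat.exists_eq_add_of_le' hm
    intro h
    have := congrArg Fin.val h
    have h2 : ((2 : Fin (n + 3)) : ℕ) = 2 := Nat.mod_eq_of_lt (show 2 < n + 3 by omega)
    have h1 : ((1 : Fin (n + 3)) : ℕ) = 1 := Nat.mod_eq_of_lt (show 1 < n + 3 by omega)
    rw [h2, h1] at this
    omega
  obtain ⟨g0, -⟩ := (hgen.2.1 0).nonempty
  have hsinj : ∀ i j, s i = s j → i = j := fun i j h => by rw [← hs i, ← hs j, h]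
  obtain ⟨g, gi, gp, gc⟩ := two_point_amalgam G A hG hA g0 (s 0) (s 1) (by rw [hs, hs]; exact h01)
  have hmem : G.colour (g (s 0)) (g (s 1)) ∈ L.C 0 1 := by
    have := G.colour_mem (g (s 0)) (g (s 1)) (by rw [gp, gp, hs, hs]; exact h01)
    rwa [gp, gp, hs, hs] at this
  refine ⟨G.colour (g (s 0)) (g (s 1)), hmem, ?_, ?_⟩
  · intro hc
    apply hA.2.1
    have h1 : G.colour (g (s 0)) (g (s 1)) = A.colour (s 0) (s 1) := by
      rw [hc, hα _ _ (by rw [hs, hs]; exact h01), hs, hs]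
    refine ⟨g, gi, gp, ?_⟩
    intro x y hxy
    by_cases h : (x = s 0 ∧ y = s 1) ∨ (x = s 1 ∧ y = s 0)
    · rcases h with ⟨rfl, rfl⟩ | ⟨rfl, rfl⟩
      · exact h1
      · rw [G.colour_symm, A.colour_symm]
        exact h1
    · exact gc x y hxy h
  · have hcol : ∀ i j : Fin m, i ≠ j → ¬ ((i = 0 ∧ j = 1) ∨ (i = 1 ∧ j = 0)) →
        G.colour (g (s i)) (g (s j)) = α i j := by
      intro i j hij hn
      rw [gc (s i) (s j) (by rw [hs, hs]; exact hij), hα _ _ (by rw [hs, hs]; exact hij), hs, hs]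
      rintro (⟨h, h'⟩ | ⟨h, h'⟩)
      · exact hn (Or.inl ⟨hsinj _ _ h, hsinj _ _ h'⟩)
      · exact hn (Or.inr ⟨hsinj _ _ h, hsinj _ _ h'⟩)
    let B : LGraph L :=
      { V := Fin m
        part := id
        colour := fun i j => G.colour (g (s i)) (g (s j))
        colour_symm := fun i j => G.colour_symm _ _
        colour_mem := fun i j h => by
          have := G.colour_mem (g (s i)) (g (s j)) (by rw [gp, gp, hs, hs]; exact h)
          rwa [gp, gp, hs, hs] at this }
    refine ⟨B, ⟨fun x y h => h, fun i => ⟨i, rfl⟩, ?_, ?_, ?_⟩, fun i => g (s i), ?_, ?_, ?_⟩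
    · rintro x y hx hy
      change x = 0 at hx
      change y = 1 at hy
      subst hx hy
      rfl
    · rintro x y hx hy
      change x = 1 at hx
      change y = 2 at hy
      subst hx hy
      refine hcol 1 2 h12 ?_
      rintro (⟨h, -⟩ | ⟨-, h⟩)
      · exact h01 h.symm
      · exact h02 h.symm
    · intro x y hxy h1 _
      exact hcol x y hxy h1
    · exact fun i j h => hsinj i j (gi h)
    · intro i
      exact (gp _).trans (hs i)
    · intro i j _
      rfl
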